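/- If u₁, u₂ are words over V with u₁u₂ nonempty and u₁u₂ not of the form a^n for any letter a and n ≥ 1, then for every letter a ∈ V at least one of the words u₁u₂ and u₁au₂ is primitive. -/

import Mathlib

/-- `wpow v n` is the word `v` repeated `n` times. -/
def wpow {V : Type*} (v : List V) : ℕ → List V
  | 0 => []
  | n + 1 => v ++ wpow v n

/-- A word is primitive if it is nonempty and not a proper power. -/
def Primitive {V : Type*} (w : List V) : Prop :=
  w ≠ [] ∧ ∀ (v : List V) (n : ℕ), w = wpow v n → n = 1

/-- A word is ins-robust if it is primitive and inserting any letter at any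
position yields a primitive word. -/
def InsRobust {V : Type*} (w : List V) : Prop :=
  Primitive w ∧ ∀ (x y : List V) (a : V), w = x ++ y → Primitive (x ++ a :: y)

/-- `HasPeriod w p` : the word `w` is periodic with period `p`. -/
def HasPeriod {V : Type*} (w : List V) (p : ℕ) : Prop :=
  ∀ i, i + p < w.length → w[i]? = w[i + p]?

theorem length_wpow {V : Type*} (v : List V) (n : ℕ) :
    (wpow v n).length = n * v.length := by
  induction n with
  | zero => simp [wpow]
  | succ n ih => simp [wpow, ih]; ring

theorem getElem?_wpow {V : Type*} (v : List V) (n i : ℕ) (hi : i < n * v.length) :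
    (wpow v n)[i]? = v[i % v.length]? := by
  induction n generalizing i with
  | zero => simp at hi
  | succ n ih =>
    rw [wpow]
    rcases lt_or_ge i v.length with hlt | hge
    · rw [List.getElem?_append_left hlt, Nat.mod_eq_of_lt hlt]
    · rw [List.getElem?_append_right hge, Nat.mod_eq_sub_mod hge]
      apply ih
      rw [Nat.add_mul, Nat.one_mul] at hi
      omega

theorem wpow_singleton {V : Type*} (b : V) (n : ℕ) : wpow [b] n = List.replicate n b := by
  induction n with
  | zero => rfl
  | succ n ih => simp [wpow, ih, List.replicate_succ]

/-- A nonempty word that is not primitive is a power with exponent at least two. -/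
theorem exists_wpow_of_not_primitive {V : Type*} {w : List V} (hw : w ≠ [])
    (h : ¬ Primitive w) : ∃ (v : List V) (n : ℕ), w = wpow v n ∧ 2 ≤ n ∧ 0 < v.length := by
  simp only [Primitive, not_and, not_forall] at h
  obtain ⟨v, n, hvn, hn⟩ := h hw
  have hlen : 0 < n * v.length := by
    rw [← length_wpow, ← hvn]
    exact List.length_pos_iff.mpr hw
  have hn0 : 0 < n := Nat.pos_of_mul_pos_right hlen
  exact ⟨v, n, hvn, by omega, Nat.pos_of_mul_pos_left hlen⟩

/-- The coprime case of the Fine–Wilf theorem, for sequences restricted to `[0, N)`. -/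
theorem eq_zero_of_coprime_periods {α : Type*} (f : ℕ → α) (p q N : ℕ) (hp : 0 < p)
    (hq : 0 < q) (hpq : Nat.Coprime p q) (hN : p + q ≤ N)
    (hfp : ∀ i, i + p < N → f (i + p) = f i) (hfq : ∀ i, i + q < N → f (i + q) = f i)
    (i : ℕ) (hi : i < N) : f i = f 0 := by
  induction hs : p + q using Nat.strong_induction_on generalizing p q N i with
  | _ s ih =>
  wlog hle : p ≤ q generalizing p q
  · exact this q p hq hp hpq.symm (by omega) hfq hfp (by omega) (by omega)
  rcases hle.eq_or_lt with rfl | hlt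
  · obtain rfl : p = 1 := by simpa using hpq
    clear ih
    induction i with
    | zero => rfl
    | succ i ihi => rw [hfp i hi, ihi (by omega)]
  · have key : ∀ j, j < N - p → f j = f 0 := fun j hj =>
      ih (p + (q - p)) (by omega) p (q - p) (N - p) hp (by omega)
        ((Nat.coprime_sub_self_right hle).mpr hpq) (by omega)
        (fun i hi => hfp i (by omega))
        (fun i hi => by
          rw [← hfq i (by omega), ← hfp (i + (q - p)) (by omega)]
          congr 1
          omega)
        j hj rfl
    rcases lt_or_ge i (N - p) with h1 | h1
    · exact key i h1
    · have h2 := hfp (i - p) (by omega)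
      rw [Nat.sub_add_cancel (by omega)] at h2
      rw [h2, key _ (by omega)]

theorem stmt1 {V : Type*} (hV : ∃ a b : V, a ≠ b) (u₁ u₂ : List V)
    (hne : u₁ ++ u₂ ≠ [])
    (h : ∀ (a : V) (n : ℕ), 1 ≤ n → u₁ ++ u₂ ≠ wpow [a] n) (a : V) :
    Primitive (u₁ ++ u₂) ∨ Primitive (u₁ ++ a :: u₂) := by
  by_contra hcon
  rw [not_or] at hcon
  obtain ⟨v, n, hv, hn, hp⟩ := exists_wpow_of_not_primitive hne hcon.1
  obtain ⟨w, m, hw, hm, hq⟩ := exists_wpow_of_not_primitive (by simp) hcon.2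
  have hN : u₁.length + u₂.length = n * v.length := by
    rw [← length_wpow, ← hv, List.length_append]
  have hM : u₁.length + u₂.length + 1 = m * w.length := by
    rw [← length_wpow, ← hw, List.length_append, List.length_cons, Nat.add_assoc]
  have hxv : ∀ i, i < u₁.length + u₂.length →
      (u₁ ++ u₂)[i]? = v[i % v.length]? := fun i hi => by
    rw [hv, getElem?_wpow v n i (by omega)]
  have hyw : ∀ i, i < u₁.length + u₂.length + 1 →
      (u₁ ++ a :: u₂)[i]? = w[i % w.length]? := fun i hi => by
    rw [hw, getElem?_wpow w m i (by omega)]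
  have hzv : ∀ i, i < u₁.length + u₂.length →
      (u₂ ++ u₁)[i]? = v[(u₁.length + i) % v.length]? := fun i hi => by
    rcases lt_or_ge i u₂.length with h1 | h1
    · rw [← hxv _ (by omega), List.getElem?_append_left h1,
        List.getElem?_append_right (by omega), Nat.add_sub_cancel_left]
    · have h2 : u₁.length + i = (i - u₂.length) + n * v.length := by omega
      rw [h2, Nat.add_mul_mod_self_right, ← hxv _ (by omega), List.getElem?_append_right h1,
        List.getElem?_append_left (by omega)]
  have hzw : ∀ i, i < u₁.length + u₂.length →
      (u₂ ++ u₁)[i]? = w[(u₁.length + i + 1) % w.length]? := fun i hi => by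
    rcases lt_or_ge i u₂.length with h1 | h1
    · rw [← hyw _ (by omega), List.getElem?_append_left h1,
        List.getElem?_append_right (by omega),
        show u₁.length + i + 1 - u₁.length = i + 1 by omega, List.getElem?_cons_succ]
    · have h2 : u₁.length + i + 1 = (i - u₂.length) + m * w.length := by omega
      rw [h2, Nat.add_mul_mod_self_right, ← hyw _ (by omega), List.getElem?_append_right h1,
        List.getElem?_append_left (by omega)]
  have hcop : Nat.Coprime v.length w.length := by
    have h1 : Nat.gcd v.length w.length ∣ n * v.length :=
      (Nat.gcd_dvd_left _ _).mul_left n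
    have h2 : Nat.gcd v.length w.length ∣ n * v.length + 1 := by
      rw [← hN, hM]
      exact (Nat.gcd_dvd_right _ _).mul_left m
    exact Nat.dvd_one.mp ((Nat.dvd_add_right h1).mp h2)
  have hlen : v.length + w.length ≤ u₁.length + u₂.length := by
    have h1 := Nat.mul_le_mul_right v.length hn
    have h2 := Nat.mul_le_mul_right w.length hm
    omega
  have hconst := eq_zero_of_coprime_periods (fun i => (u₂ ++ u₁)[i]?) v.length w.length
    (u₁.length + u₂.length) hp hq hcop hlen
    (fun i hi => by
      rw [hzv _ hi, hzv i (by omega), ← Nat.add_assoc, Nat.add_mod_right])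
    (fun i hi => by
      rw [hzw _ hi, hzw i (by omega),
        show u₁.length + (i + w.length) + 1 = u₁.length + i + 1 + w.length by omega,
        Nat.add_mod_right])
  have h0 : 0 < (u₂ ++ u₁).length := by
    rw [List.length_append]
    omega
  refine h (u₂ ++ u₁)[0] (u₁.length + u₂.length) (by omega) ?_
  rw [wpow_singleton, List.eq_replicate_iff]
  refine ⟨List.length_append, fun b hb => ?_⟩
  have hb' : b ∈ u₂ ++ u₁ := by
    rw [List.mem_append] at hb ⊢
    exact hb.symm
  obtain ⟨i, hi, rfl⟩ := List.mem_iff_getElem.mp hb'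
  have h1 := hconst i (by rw [List.length_append] at hi; omega)
  simpa only [List.getElem?_eq_getElem hi, List.getElem?_eq_getElem h0,
    Option.some.injEq] using h1
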